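/- Let d > 1 and M ≥ 1 be real numbers and let r(1), r(2), r(3), … be a sequence of integers such that d^{2·r(1)} ≤ √M and such that for every i ≥ 2, √M/d < d^{r(i−1)+r(i)}/e^{2(i−1)} ≤ √M. Then r(2) ≥ r(1), r(i+2) ≥ r(i) for every i ≥ 1 (so the subsequences of even-indexed and of odd-indexed terms are nondecreasing), and consequently r(i) ≥ r(1) for every i ≥ 1. -/

import Mathlib

theorem aux_le (d S E E' : ℝ) (a b : ℤ) (hd : 1 < d) (hE : 0 < E) (hEE : E ≤ E') (hS : 0 ≤ S)
    (ha : d ^ a / E ≤ S) (hb : S / d < d ^ b / E') : a ≤ b := by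
  have hd0 : 0 < d := by linarith
  have hE' : 0 < E' := by linarith
  rw [div_le_iff₀ hE] at ha
  rw [div_lt_div_iff₀ hd0 hE'] at hb
  have h3 : S * E ≤ S * E' := mul_le_mul_of_nonneg_left hEE hS
  have h4 : d ^ a < d ^ (b + 1) := by
    rw [zpow_add_one₀ hd0.ne']
    linarith
  have := (zpow_lt_zpow_iff_right₀ hd).1 h4
  omega

/-- Let `d > 1`, `M ≥ 1` and let `r 1, r 2, …` be integers with
`d^(2 r 1) ≤ √M` and, for every `i ≥ 2`, `√M/d < d^(r (i-1) + r i)/e^(2(i-1)) ≤ √M`.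
Then `r 2 ≥ r 1`, `r (i+2) ≥ r i` for all `i ≥ 1`, and `r i ≥ r 1` for all `i ≥ 1`. -/
theorem stmt_5 (d M : ℝ) (hd : 1 < d) (hM : 1 ≤ M) (r : ℕ → ℤ)
    (h1 : d ^ (2 * r 1) ≤ Real.sqrt M)
    (h2 : ∀ i : ℕ, 2 ≤ i →
      Real.sqrt M / d < d ^ (r (i - 1) + r i) / Real.exp (2 * ((i : ℝ) - 1)) ∧
      d ^ (r (i - 1) + r i) / Real.exp (2 * ((i : ℝ) - 1)) ≤ Real.sqrt M) :
    r 2 ≥ r 1 ∧ (∀ i : ℕ, 1 ≤ i → r (i + 2) ≥ r i) ∧ (∀ i : ℕ, 1 ≤ i → r i ≥ r 1) := by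
  have hS := Real.sqrt_nonneg M
  have A : r 2 ≥ r 1 := by
    have h := (h2 2 le_rfl).1
    have := aux_le d (Real.sqrt M) 1 _ (2 * r 1) _ hd one_pos
      (Real.one_le_exp (by norm_num)) hS (by simpa using h1) h
    simp only [Nat.reduceSub] at this
    omega
  have B : ∀ i : ℕ, 1 ≤ i → r (i + 2) ≥ r i := by
    intro i hi
    have ha := (h2 (i + 1) (by omega)).2
    have hb := (h2 (i + 2) (by omega)).1
    have := aux_le d (Real.sqrt M) _ _ _ _ hd (Real.exp_pos _)
      (Real.exp_le_exp.2 (by push_cast; linarith)) hS ha hb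
    have e1 : i + 1 - 1 = i := by omega
    have e2 : i + 2 - 1 = i + 1 := by omega
    rw [e1, e2] at this
    omega
  refine ⟨A, B, ?_⟩
  intro i
  induction i using Nat.strong_induction_on with
  | _ i ih =>
    intro hi
    by_cases c1 : i = 1
    · subst c1; exact le_rfl
    by_cases c2 : i = 2
    · subst c2; exact A
    obtain ⟨k, rfl⟩ : ∃ k, i = k + 2 := ⟨i - 2, by omega⟩
    exact (ih k (by omega) (by omega)).trans (B k (by omega))
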